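/- Let H₁, H₂ be finite-dimensional complex Hilbert spaces and U a unitary on H₁ ⊗ H₂. The following are equivalent: (i) U = U₁ ⊗ U₂ for some unitaries U₁, U₂; (ii) for every density matrix ρ, every CPTP map Ψ on operators of H₁, Tr₁(U (Ψ ⊗ id)(ρ) U†) = Tr₁(U ρ U†); (iii) for every density matrix ρ and every Hermitian A on H₁ with spectral projections (Π_x), Tr₁(∑_x U (Π_x ⊗ 1) ρ (Π_x ⊗ 1) U†) = Tr₁(U ρ U†). -/

import Mathlib

open Matrix Kronecker BigOperators
open scoped ComplexOrder

noncomputable section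

/-- Partial trace over the first tensor factor. -/
def ptrace1 {n m : Type} [Fintype n] (ρ : Matrix (n × m) (n × m) ℂ) : Matrix m m ℂ :=
  Matrix.of fun k l => ∑ i, ρ (i, k) (i, l)

/-- A density matrix: positive semidefinite with trace one. -/
def IsDensityMatrix {d : Type} [Fintype d] [DecidableEq d] (ρ : Matrix d d ℂ) : Prop :=
  ρ.PosSemidef ∧ ρ.trace = 1

/-- A complete family of mutually orthogonal Hermitian projections. -/
def IsProjFamily {n ι : Type} [Fintype n] [DecidableEq n] [Fintype ι] [DecidableEq ι]
    (P : ι → Matrix n n ℂ) : Prop :=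
  (∀ i, (P i).IsHermitian) ∧ (∀ i j, P i * P j = if i = j then P i else 0) ∧ ∑ i, P i = 1

/-- `(P, μ)` is the spectral decomposition of the Hermitian operator `A`. -/
def IsSpectralDecomp {n ι : Type} [Fintype n] [DecidableEq n] [Fintype ι] [DecidableEq ι]
    (A : Matrix n n ℂ) (P : ι → Matrix n n ℂ) (μ : ι → ℝ) : Prop :=
  IsProjFamily P ∧ Function.Injective μ ∧ A = ∑ i, (μ i : ℂ) • P i

section Polarization

variable {d : Type} [Fintype d]

theorem vecMulVec_star_mul_self {v : d → ℂ} (hv : star v ⬝ᵥ v = 1) :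
    vecMulVec v (star v) * vecMulVec v (star v) = vecMulVec v (star v) := by
  rw [vecMulVec_mul_vecMulVec, hv]
  simp

theorem isHermitian_vecMulVec_star (v : d → ℂ) : (vecMulVec v (star v)).IsHermitian :=
  (posSemidef_vecMulVec_self_star v).isHermitian

variable [DecidableEq d]

/-- Rank-one projections span the full matrix algebra. -/
theorem Submodule.eq_top_of_vecMulVec_star_mem (S : Submodule ℂ (Matrix d d ℂ))
    (h : ∀ v : d → ℂ, star v ⬝ᵥ v = 1 → vecMulVec v (star v) ∈ S) : S = ⊤ := by
  have hall : ∀ v : d → ℂ, vecMulVec v (star v) ∈ S := by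
    intro v
    by_cases hv : v = 0
    · simp [hv]
    have hpos : 0 < ∑ i, ‖v i‖ ^ 2 := by
      obtain ⟨i, hi⟩ := Function.ne_iff.mp hv
      exact Finset.sum_pos' (fun _ _ => by positivity)
        ⟨i, Finset.mem_univ i, by have : v i ≠ 0 := hi
                                  positivity⟩
    set r : ℝ := √(∑ i, ‖v i‖ ^ 2) with hr
    have hr0 : (r : ℂ) ≠ 0 := by
      exact_mod_cast (Real.sqrt_pos.mpr hpos).ne'
    have hnorm : star v ⬝ᵥ v = (r : ℂ) * r := by
      rw [← Complex.ofReal_mul, hr, Real.mul_self_sqrt hpos.le]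
      simp [dotProduct, ← Complex.conj_mul']
    have hunit := h ((r : ℂ)⁻¹ • v) (by
      simp [star_smul, hnorm]
      field_simp)
    have := S.smul_mem ((r : ℂ) * r) hunit
    convert this using 1
    ext i j
    simp [vecMulVec_apply]
    field_simp
  have hpol : ∀ x y : d → ℂ, vecMulVec x (star y) ∈ S := by
    intro x y
    have key : vecMulVec x (star y) = (4 : ℂ)⁻¹ •
        (vecMulVec (x + y) (star (x + y)) - vecMulVec (x - y) (star (x - y))
          + Complex.I • vecMulVec (x + Complex.I • y) (star (x + Complex.I • y))
          - Complex.I • vecMulVec (x - Complex.I • y) (star (x - Complex.I • y))) := by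
      ext i j
      simp [vecMulVec_apply]
      ring_nf
      simp
      ring
    rw [key]
    exact S.smul_mem _ (S.sub_mem (S.add_mem (S.sub_mem (hall _) (hall _))
      (S.smul_mem _ (hall _))) (S.smul_mem _ (hall _)))
  refine eq_top_iff.mpr fun X _ => ?_
  rw [matrix_eq_sum_single X]
  refine S.sum_mem fun i _ => S.sum_mem fun j _ => ?_
  have : single i j (X i j) = X i j • vecMulVec (Pi.single i 1) (star (Pi.single j (1 : ℂ))) := by
    ext a b
    simp [single_apply, vecMulVec_apply, Pi.single_apply, eq_comm]
    grind
  rw [this]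
  exact S.smul_mem _ (hpol _ _)

theorem isDensityMatrix_vecMulVec_star {v : d → ℂ} (hv : star v ⬝ᵥ v = 1) :
    IsDensityMatrix (vecMulVec v (star v)) :=
  ⟨posSemidef_vecMulVec_self_star v, by rw [trace_vecMulVec, dotProduct_comm, hv]⟩

theorem isSpectralDecomp_of_isHermitian_of_mul_self {P : Matrix d d ℂ} (hP : P.IsHermitian)
    (hPP : P * P = P) :
    IsSpectralDecomp P (fun b : Bool => if b then P else 1 - P)
      (fun b : Bool => if b then 1 else 0) := by
  refine ⟨⟨?_, ?_, ?_⟩, ?_, ?_⟩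
  · rintro (_ | _)
    · simpa using isHermitian_one.sub hP
    · simpa using hP
  · rintro (_ | _) (_ | _) <;> simp [mul_sub, sub_mul, hPP]
  · simp
  · rintro (_ | _) (_ | _) <;> simp
  · simp

end Polarization

section PartialTrace

variable {n m : Type} [Fintype n]

theorem ptrace1_add (X Y : Matrix (n × m) (n × m) ℂ) :
    ptrace1 (X + Y) = ptrace1 X + ptrace1 Y := by
  ext; simp [ptrace1, Finset.sum_add_distrib]

theorem ptrace1_smul (c : ℂ) (X : Matrix (n × m) (n × m) ℂ) :
    ptrace1 (c • X) = c • ptrace1 X := by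
  ext; simp [ptrace1, Finset.mul_sum]

theorem ptrace1_zero : ptrace1 (0 : Matrix (n × m) (n × m) ℂ) = 0 := by
  ext; simp [ptrace1]

theorem ptrace1_sum {ι : Type} (s : Finset ι) (X : ι → Matrix (n × m) (n × m) ℂ) :
    ptrace1 (∑ i ∈ s, X i) = ∑ i ∈ s, ptrace1 (X i) := by
  ext a b
  simp only [ptrace1, Matrix.sum_apply, of_apply]
  exact Finset.sum_comm

variable [Fintype m]

theorem ptrace1_kronecker_one_mul_comm [DecidableEq m] (A : Matrix n n ℂ)
    (X : Matrix (n × m) (n × m) ℂ) :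
    ptrace1 ((A ⊗ₖ (1 : Matrix m m ℂ)) * X) = ptrace1 (X * (A ⊗ₖ (1 : Matrix m m ℂ))) := by
  ext a b
  simp only [ptrace1, of_apply, mul_apply, Fintype.sum_prod_type, kroneckerMap_apply, one_apply,
    mul_ite, ite_mul, mul_one, mul_zero, zero_mul, Finset.sum_ite_eq, Finset.sum_ite_eq',
    Finset.mem_univ, if_true]
  rw [Finset.sum_comm]
  simp only [mul_comm]

variable [DecidableEq n]

theorem ptrace1_one_kronecker_mul (B : Matrix m m ℂ) (X : Matrix (n × m) (n × m) ℂ) :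
    ptrace1 (((1 : Matrix n n ℂ) ⊗ₖ B) * X) = B * ptrace1 X := by
  ext a b
  simp only [ptrace1, of_apply, mul_apply, Fintype.sum_prod_type, kroneckerMap_apply, one_apply,
    ite_mul, one_mul, zero_mul, Finset.sum_ite_irrel, Finset.sum_const_zero, Finset.sum_ite_eq,
    Finset.mem_univ, if_true, Finset.mul_sum]
  exact Finset.sum_comm

theorem ptrace1_mul_one_kronecker (B : Matrix m m ℂ) (X : Matrix (n × m) (n × m) ℂ) :
    ptrace1 (X * ((1 : Matrix n n ℂ) ⊗ₖ B)) = ptrace1 X * B := by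
  ext a b
  simp only [ptrace1, of_apply, mul_apply, Fintype.sum_prod_type, kroneckerMap_apply, one_apply,
    ite_mul, mul_ite, one_mul, zero_mul, mul_zero, Finset.sum_ite_irrel, Finset.sum_const_zero,
    Finset.sum_ite_eq', Finset.mem_univ, if_true, Finset.sum_mul]
  exact Finset.sum_comm

variable [DecidableEq m]

theorem ptrace1_kronecker_mul_mul_kronecker (A C : Matrix n n ℂ) (B D : Matrix m m ℂ)
    (X : Matrix (n × m) (n × m) ℂ) :
    ptrace1 ((A ⊗ₖ B) * X * (C ⊗ₖ D)) =
      B * ptrace1 (((C * A) ⊗ₖ (1 : Matrix m m ℂ)) * X) * D := by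
  have hAB : A ⊗ₖ B = ((1 : Matrix n n ℂ) ⊗ₖ B) * (A ⊗ₖ (1 : Matrix m m ℂ)) := by
    simp [← mul_kronecker_mul]
  have hCD : C ⊗ₖ D = (C ⊗ₖ (1 : Matrix m m ℂ)) * ((1 : Matrix n n ℂ) ⊗ₖ D) := by
    simp [← mul_kronecker_mul]
  have hCA : (C * A) ⊗ₖ (1 : Matrix m m ℂ) =
      (C ⊗ₖ (1 : Matrix m m ℂ)) * (A ⊗ₖ (1 : Matrix m m ℂ)) := by
    simp [← mul_kronecker_mul]
  rw [hAB, hCD, hCA, ← Matrix.mul_assoc, ptrace1_mul_one_kronecker,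
    Matrix.mul_assoc (C ⊗ₖ _), ptrace1_kronecker_one_mul_comm C]
  simp only [Matrix.mul_assoc]
  rw [ptrace1_one_kronecker_mul]
  simp only [Matrix.mul_assoc]

theorem ptrace1_kronecker_kraus {ι : Type} [Fintype ι] {U₁ : Matrix n n ℂ}
    (hU₁ : U₁ ∈ unitaryGroup n ℂ) (U₂ : Matrix m m ℂ) (K : ι → Matrix n n ℂ)
    (hK : ∑ i, (K i)ᴴ * K i = 1) (ρ : Matrix (n × m) (n × m) ℂ) :
    ptrace1 ((U₁ ⊗ₖ U₂) * (∑ i, (K i ⊗ₖ (1 : Matrix m m ℂ)) * ρ *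
      (K i ⊗ₖ (1 : Matrix m m ℂ))ᴴ) * (U₁ ⊗ₖ U₂)ᴴ) =
    ptrace1 ((U₁ ⊗ₖ U₂) * ρ * (U₁ ⊗ₖ U₂)ᴴ) := by
  have hU : U₁ᴴ * U₁ = 1 := (mem_unitaryGroup_iff').mp hU₁
  have hterm : ∀ i, (U₁ ⊗ₖ U₂) * ((K i ⊗ₖ (1 : Matrix m m ℂ)) * ρ *
      (K i ⊗ₖ (1 : Matrix m m ℂ))ᴴ) * (U₁ ⊗ₖ U₂)ᴴ =
      ((U₁ * K i) ⊗ₖ U₂) * ρ * (((K i)ᴴ * U₁ᴴ) ⊗ₖ U₂ᴴ) := by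
    intro i
    have h₁ : (U₁ * K i) ⊗ₖ U₂ = (U₁ ⊗ₖ U₂) * (K i ⊗ₖ (1 : Matrix m m ℂ)) := by
      simp [← mul_kronecker_mul]
    have h₂ : ((K i)ᴴ * U₁ᴴ) ⊗ₖ U₂ᴴ = (K i ⊗ₖ (1 : Matrix m m ℂ))ᴴ * (U₁ ⊗ₖ U₂)ᴴ := by
      simp [conjTranspose_kronecker, ← mul_kronecker_mul]
    rw [h₁, h₂]
    simp only [Matrix.mul_assoc]
  have hKK : ∀ i, (K i)ᴴ * U₁ᴴ * (U₁ * K i) = (K i)ᴴ * K i := by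
    intro i
    rw [Matrix.mul_assoc, ← Matrix.mul_assoc U₁ᴴ, hU, Matrix.one_mul]
  have hsum : ∑ i, ((K i)ᴴ * K i) ⊗ₖ (1 : Matrix m m ℂ) = 1 := by
    rw [← one_kronecker_one, ← hK]
    ext a b
    simp [Matrix.sum_apply, Finset.sum_mul]
  simp only [Matrix.mul_sum, Matrix.sum_mul, ptrace1_sum, hterm,
    ptrace1_kronecker_mul_mul_kronecker, hKK]
  rw [conjTranspose_kronecker, ptrace1_kronecker_mul_mul_kronecker, hU, one_kronecker_one,
    ← Matrix.sum_mul, ← Matrix.mul_sum, ← ptrace1_sum, ← Matrix.sum_mul, hsum]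

/-- If `Z` commutes with every `Y` under the partial trace over the first factor, then `Z` acts
trivially on the second factor. -/
theorem eq_ite_of_ptrace1_mul_comm {Z : Matrix (n × m) (n × m) ℂ}
    (hZ : ∀ Y, ptrace1 (Z * Y) = ptrace1 (Y * Z)) (i k : n) (a₀ a b : m) :
    Z (i, a) (k, b) = if a = b then Z (i, a₀) (k, a₀) else 0 := by
  have key : ∀ c d a b : m, (if d = b then Z (i, a) (k, c) else 0) =
      if c = a then Z (i, d) (k, b) else 0 := by
    intro c d a b
    have := congrFun (congrFun (hZ (single (k, c) (i, d) 1)) a) b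
    simpa [ptrace1, mul_apply, single_apply, Fintype.sum_prod_type, Prod.ext_iff, ite_and,
      eq_comm] using this
  split_ifs with hab
  · subst hab
    simpa using key a a₀ a a₀
  · simpa [Ne.symm hab] using key b b a b

/-- A unitary for which every `U (A ⊗ 1) Uᴴ` acts trivially on the second factor factorizes. -/
theorem exists_eq_kronecker_of_ptrace1_mul_comm {U : Matrix (n × m) (n × m) ℂ}
    (hU : U ∈ unitaryGroup (n × m) ℂ)
    (h : ∀ (A : Matrix n n ℂ) (Y : Matrix (n × m) (n × m) ℂ),
      ptrace1 (U * (A ⊗ₖ (1 : Matrix m m ℂ)) * Uᴴ * Y) =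
        ptrace1 (Y * (U * (A ⊗ₖ (1 : Matrix m m ℂ)) * Uᴴ))) :
    ∃ U₁ U₂, U₁ ∈ unitaryGroup n ℂ ∧ U₂ ∈ unitaryGroup m ℂ ∧ U = U₁ ⊗ₖ U₂ := by
  have hUU : Uᴴ * U = 1 := (mem_unitaryGroup_iff').mp hU
  by_cases hU0 : U = 0
  · have : IsEmpty (n × m) := by
      by_contra hne
      rw [not_isEmpty_iff] at hne
      rw [hU0, Matrix.mul_zero] at hUU
      exact zero_ne_one hUU
    exact ⟨1, 1, one_mem _, one_mem _, by ext x; exact isEmptyElim x⟩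
  obtain ⟨i, a₀, j, c₀, hne⟩ : ∃ i a j c, U (i, a) (j, c) ≠ 0 := by
    by_contra! hcon
    exact hU0 (by ext ⟨i, a⟩ ⟨j, c⟩; exact hcon i a j c)
  let B : n → n → Matrix m m ℂ := fun k l => of fun a c => U (k, a) (l, c)
  have hB : ∀ k l k' l', ∃ z : ℂ, B k l * (B k' l')ᴴ = z • (1 : Matrix m m ℂ) := by
    intro k l k' l'
    refine ⟨(U * (single l l' 1 ⊗ₖ (1 : Matrix m m ℂ)) * Uᴴ : Matrix (n × m) (n × m) ℂ)
      (k, a₀) (k', a₀), ?_⟩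
    ext a b
    have hent := eq_ite_of_ptrace1_mul_comm (h (single l l' 1)) k k' a₀ a b
    rw [Matrix.smul_apply, one_apply, smul_eq_mul, mul_ite, mul_one, mul_zero, ← hent]
    simp [B, mul_apply, Fintype.sum_prod_type, single_apply, one_apply, ite_and]
  let W := B i j
  obtain ⟨z, hz⟩ := hB i j i j
  have hzr : z = ((∑ c, ‖U (i, a₀) (j, c)‖ ^ 2 : ℝ) : ℂ) := by
    have := congrFun (congrFun hz a₀) a₀
    simpa [B, mul_apply, Complex.mul_conj'] using this.symm
  have hpos : 0 < ∑ c, ‖U (i, a₀) (j, c)‖ ^ 2 :=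
    Finset.sum_pos' (fun _ _ => by positivity) ⟨c₀, Finset.mem_univ _, by positivity⟩
  set r : ℝ := √(∑ c, ‖U (i, a₀) (j, c)‖ ^ 2) with hr
  have hr0 : (r : ℂ) ≠ 0 := by exact_mod_cast (Real.sqrt_pos.mpr hpos).ne'
  have hzrr : z = (r : ℂ) * r := by
    rw [hzr, ← Complex.ofReal_mul, hr, Real.mul_self_sqrt hpos.le]
  let U₂ : Matrix m m ℂ := (r : ℂ)⁻¹ • W
  have hU₂ : U₂ * U₂ᴴ = 1 := by
    simp only [U₂, W, conjTranspose_smul, smul_mul_smul_comm, hz, smul_smul]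
    rw [hzrr]
    simp
    field_simp
    simp
  have hU₂' : U₂ᴴ * U₂ = 1 := mul_eq_one_comm.mp hU₂
  choose t ht using fun k l => hB k l i j
  let U₁ : Matrix n n ℂ := of fun k l => (r : ℂ)⁻¹ * t k l
  have hfac : U = U₁ ⊗ₖ U₂ := by
    have hblock : ∀ k l, B k l = U₁ k l • U₂ := by
      intro k l
      calc B k l = B k l * U₂ᴴ * U₂ := by rw [Matrix.mul_assoc, hU₂', Matrix.mul_one]
        _ = U₁ k l • U₂ := by
          simp [U₂, W, U₁, ht, smul_smul, mul_comm, mul_left_comm]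
    ext ⟨k, a⟩ ⟨l, c⟩
    exact congrFun (congrFun (hblock k l) a) c
  refine ⟨U₁, U₂, ?_, mem_unitaryGroup_iff.mpr hU₂, hfac⟩
  rw [hfac, conjTranspose_kronecker, ← mul_kronecker_mul, hU₂'] at hUU
  refine mem_unitaryGroup_iff'.mpr ?_
  ext k l
  have := congrFun (congrFun hUU (k, a₀)) (l, a₀)
  simpa [one_apply, star_eq_conjTranspose] using this

theorem ptrace1_mul_comm_of_measurement {U : Matrix (n × m) (n × m) ℂ}
    (hU : U ∈ unitaryGroup (n × m) ℂ)
    (h : ∀ P : Matrix n n ℂ, P.IsHermitian → P * P = P →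
      ∀ ρ : Matrix (n × m) (n × m) ℂ, IsDensityMatrix ρ →
        ptrace1 (U * (P ⊗ₖ (1 : Matrix m m ℂ)) * ρ * (P ⊗ₖ (1 : Matrix m m ℂ)) * Uᴴ) +
          ptrace1 (U * ((1 - P) ⊗ₖ (1 : Matrix m m ℂ)) * ρ *
            ((1 - P) ⊗ₖ (1 : Matrix m m ℂ)) * Uᴴ) = ptrace1 (U * ρ * Uᴴ))
    (A : Matrix n n ℂ) (Y : Matrix (n × m) (n × m) ℂ) :
    ptrace1 (U * (A ⊗ₖ (1 : Matrix m m ℂ)) * Uᴴ * Y) =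
      ptrace1 (Y * (U * (A ⊗ₖ (1 : Matrix m m ℂ)) * Uᴴ)) := by
  have hUU : U * Uᴴ = 1 := (mem_unitaryGroup_iff).mp hU
  have hlin : ∀ P : Matrix n n ℂ, P.IsHermitian → P * P = P → ∀ X : Matrix (n × m) (n × m) ℂ,
      ptrace1 (U * (P ⊗ₖ (1 : Matrix m m ℂ)) * X * (P ⊗ₖ (1 : Matrix m m ℂ)) * Uᴴ) +
          ptrace1 (U * ((1 - P) ⊗ₖ (1 : Matrix m m ℂ)) * X *
            ((1 - P) ⊗ₖ (1 : Matrix m m ℂ)) * Uᴴ) = ptrace1 (U * X * Uᴴ) := by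
    intro P hP hPP X
    let S : Submodule ℂ (Matrix (n × m) (n × m) ℂ) :=
      { carrier := {X | ptrace1 (U * (P ⊗ₖ (1 : Matrix m m ℂ)) * X *
            (P ⊗ₖ (1 : Matrix m m ℂ)) * Uᴴ) +
          ptrace1 (U * ((1 - P) ⊗ₖ (1 : Matrix m m ℂ)) * X *
            ((1 - P) ⊗ₖ (1 : Matrix m m ℂ)) * Uᴴ) = ptrace1 (U * X * Uᴴ)}
        zero_mem' := by simp [ptrace1_zero]
        add_mem' := by
          intro X Y hX hY
          simp only [Set.mem_ofPred_eq] at hX hY ⊢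
          simp only [Matrix.mul_add, Matrix.add_mul, ptrace1_add]
          rw [← hX, ← hY]
          abel
        smul_mem' := by
          intro c X hX
          simp only [Set.mem_ofPred_eq] at hX ⊢
          simp only [Matrix.mul_smul, Matrix.smul_mul, ptrace1_smul]
          rw [← hX, smul_add] }
    have hS : S = ⊤ := S.eq_top_of_vecMulVec_star_mem fun v hv =>
      h P hP hPP _ (isDensityMatrix_vecMulVec_star hv)
    exact (hS ▸ Submodule.mem_top : X ∈ S)
  have hproj : ∀ P : Matrix n n ℂ, P.IsHermitian → P * P = P → ∀ X : Matrix (n × m) (n × m) ℂ,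
      ptrace1 (U * (P ⊗ₖ (1 : Matrix m m ℂ)) * X * Uᴴ) =
        ptrace1 (U * X * (P ⊗ₖ (1 : Matrix m m ℂ)) * Uᴴ) := by
    intro P hP hPP X
    set Q : Matrix (n × m) (n × m) ℂ := P ⊗ₖ (1 : Matrix m m ℂ) with hQ
    have hQQ : Q * Q = Q := by rw [hQ, ← mul_kronecker_mul, hPP, Matrix.one_mul]
    have hQc : (1 - P) ⊗ₖ (1 : Matrix m m ℂ) = 1 - Q := by
      rw [hQ, ← one_kronecker_one]
      ext
      simp only [kroneckerMap_apply, Matrix.sub_apply, sub_mul]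
    have hl := hlin P hP hPP
    rw [hQc, ← hQ] at hl
    have hQQ' : ∀ Z, Q * (Q * Z) = Q * Z := fun Z => by rw [← Matrix.mul_assoc, hQQ]
    have h₁ := hl (Q * X)
    have h₂ := hl (X * Q)
    simp only [Matrix.mul_sub, Matrix.sub_mul, Matrix.mul_one, Matrix.mul_assoc, hQQ, hQQ',
      sub_self, Matrix.zero_mul, ptrace1_zero, add_zero] at h₁ h₂ ⊢
    rw [← h₁, ← h₂]
  have hcomm : ∀ X : Matrix (n × m) (n × m) ℂ,
      ptrace1 (U * (A ⊗ₖ (1 : Matrix m m ℂ)) * X * Uᴴ) =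
        ptrace1 (U * X * (A ⊗ₖ (1 : Matrix m m ℂ)) * Uᴴ) := by
    intro X
    let S : Submodule ℂ (Matrix n n ℂ) :=
      { carrier := {A | ptrace1 (U * (A ⊗ₖ (1 : Matrix m m ℂ)) * X * Uᴴ) =
          ptrace1 (U * X * (A ⊗ₖ (1 : Matrix m m ℂ)) * Uᴴ)}
        zero_mem' := by simp [ptrace1_zero]
        add_mem' := by
          intro A B hA hB
          simp only [Set.mem_ofPred_eq] at hA hB ⊢
          simp only [add_kronecker, Matrix.mul_add, Matrix.add_mul, ptrace1_add, hA, hB]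
        smul_mem' := by
          intro c A hA
          simp only [Set.mem_ofPred_eq] at hA ⊢
          simp only [smul_kronecker, Matrix.mul_smul, Matrix.smul_mul, ptrace1_smul, hA] }
    have hS : S = ⊤ := S.eq_top_of_vecMulVec_star_mem fun v hv =>
      hproj _ (isHermitian_vecMulVec_star v) (vecMulVec_star_mul_self hv) X
    exact (hS ▸ Submodule.mem_top : A ∈ S)
  have hUU' : ∀ Z, U * (Uᴴ * Z) = Z := fun Z => by rw [← Matrix.mul_assoc, hUU, Matrix.one_mul]
  simpa only [Matrix.mul_assoc, hUU, hUU', Matrix.mul_one] using hcomm (Uᴴ * Y * U)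

end PartialTrace

/-- **(F) ⇔ (C) ⇔ (MC)** in finite dimension. -/
theorem factorization_iff_C_iff_MC
    (n m : Type) [Fintype n] [DecidableEq n] [Fintype m] [DecidableEq m]
    (U : Matrix (n × m) (n × m) ℂ) (hU : U ∈ Matrix.unitaryGroup (n × m) ℂ) :
    ((∃ U₁ U₂, U₁ ∈ Matrix.unitaryGroup n ℂ ∧ U₂ ∈ Matrix.unitaryGroup m ℂ ∧
        U = U₁ ⊗ₖ U₂) ↔
      (∀ (ι : Type) [Fintype ι] (K : ι → Matrix n n ℂ), ∑ i, (K i)ᴴ * K i = 1 →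
        ∀ ρ : Matrix (n × m) (n × m) ℂ, IsDensityMatrix ρ →
          ptrace1 (U * (∑ i, (K i ⊗ₖ (1 : Matrix m m ℂ)) * ρ *
              (K i ⊗ₖ (1 : Matrix m m ℂ))ᴴ) * Uᴴ)
            = ptrace1 (U * ρ * Uᴴ)))
    ∧
    ((∀ (ι : Type) [Fintype ι] (K : ι → Matrix n n ℂ), ∑ i, (K i)ᴴ * K i = 1 →
        ∀ ρ : Matrix (n × m) (n × m) ℂ, IsDensityMatrix ρ →
          ptrace1 (U * (∑ i, (K i ⊗ₖ (1 : Matrix m m ℂ)) * ρ *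
              (K i ⊗ₖ (1 : Matrix m m ℂ))ᴴ) * Uᴴ)
            = ptrace1 (U * ρ * Uᴴ)) ↔
      (∀ (ι : Type) [Fintype ι] [DecidableEq ι]
          (P : ι → Matrix n n ℂ) (μ : ι → ℝ) (A : Matrix n n ℂ),
          IsSpectralDecomp A P μ →
          ∀ ρ : Matrix (n × m) (n × m) ℂ, IsDensityMatrix ρ →
            ptrace1 (∑ x, U * (P x ⊗ₖ (1 : Matrix m m ℂ)) * ρ *
                (P x ⊗ₖ (1 : Matrix m m ℂ)) * Uᴴ)
              = ptrace1 (U * ρ * Uᴴ))) := by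
  have hFC : (∃ U₁ U₂, U₁ ∈ Matrix.unitaryGroup n ℂ ∧ U₂ ∈ Matrix.unitaryGroup m ℂ ∧
        U = U₁ ⊗ₖ U₂) →
      (∀ (ι : Type) [Fintype ι] (K : ι → Matrix n n ℂ), ∑ i, (K i)ᴴ * K i = 1 →
        ∀ ρ : Matrix (n × m) (n × m) ℂ, IsDensityMatrix ρ →
          ptrace1 (U * (∑ i, (K i ⊗ₖ (1 : Matrix m m ℂ)) * ρ *
              (K i ⊗ₖ (1 : Matrix m m ℂ))ᴴ) * Uᴴ)
            = ptrace1 (U * ρ * Uᴴ)) := by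
    rintro ⟨U₁, U₂, hU₁, -, rfl⟩ ι _ K hK ρ -
    exact ptrace1_kronecker_kraus hU₁ U₂ K hK ρ
  have hCM : (∀ (ι : Type) [Fintype ι] (K : ι → Matrix n n ℂ), ∑ i, (K i)ᴴ * K i = 1 →
        ∀ ρ : Matrix (n × m) (n × m) ℂ, IsDensityMatrix ρ →
          ptrace1 (U * (∑ i, (K i ⊗ₖ (1 : Matrix m m ℂ)) * ρ *
              (K i ⊗ₖ (1 : Matrix m m ℂ))ᴴ) * Uᴴ)
            = ptrace1 (U * ρ * Uᴴ)) →
      (∀ (ι : Type) [Fintype ι] [DecidableEq ι]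
          (P : ι → Matrix n n ℂ) (μ : ι → ℝ) (A : Matrix n n ℂ),
          IsSpectralDecomp A P μ →
          ∀ ρ : Matrix (n × m) (n × m) ℂ, IsDensityMatrix ρ →
            ptrace1 (∑ x, U * (P x ⊗ₖ (1 : Matrix m m ℂ)) * ρ *
                (P x ⊗ₖ (1 : Matrix m m ℂ)) * Uᴴ)
              = ptrace1 (U * ρ * Uᴴ)) := by
    rintro hC ι _ _ P μ A ⟨⟨hherm, hmul, hsum⟩, -, -⟩ ρ hρ
    have hherm' : ∀ x, (P x)ᴴ = P x := hherm
    rw [← hC ι P (by simpa [hherm', hmul] using hsum) ρ hρ]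
    simp only [conjTranspose_kronecker, hherm', conjTranspose_one, Matrix.mul_sum, Matrix.sum_mul,
      Matrix.mul_assoc]
  have hMF : (∀ (ι : Type) [Fintype ι] [DecidableEq ι]
          (P : ι → Matrix n n ℂ) (μ : ι → ℝ) (A : Matrix n n ℂ),
          IsSpectralDecomp A P μ →
          ∀ ρ : Matrix (n × m) (n × m) ℂ, IsDensityMatrix ρ →
            ptrace1 (∑ x, U * (P x ⊗ₖ (1 : Matrix m m ℂ)) * ρ *
                (P x ⊗ₖ (1 : Matrix m m ℂ)) * Uᴴ)
              = ptrace1 (U * ρ * Uᴴ)) →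
      (∃ U₁ U₂, U₁ ∈ Matrix.unitaryGroup n ℂ ∧ U₂ ∈ Matrix.unitaryGroup m ℂ ∧
        U = U₁ ⊗ₖ U₂) := by
    intro hM
    refine exists_eq_kronecker_of_ptrace1_mul_comm hU
      (ptrace1_mul_comm_of_measurement hU fun P hP hPP ρ hρ => ?_)
    rw [← hM Bool _ _ P (isSpectralDecomp_of_isHermitian_of_mul_self hP hPP) ρ hρ]
    simp [ptrace1_add]
  exact ⟨⟨hFC, fun hC => hMF (hCM hC)⟩, ⟨hCM, fun hM => hFC (hMF hM)⟩⟩
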